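/- For every m ≥ 1, the endpoint sequence E(S₃(m)) of the Hart–Sharir sequence S₃(m) contains a subsequence of the form (L₁ L₂ ⋯ L_m) ( ) R₁ ( ) R₂ ( ) ⋯ ( ) R_m. That is, there exist symbols 1, 2, …, m of S₃(m) whose letters L₁, …, L_m constitute (in this order) one entire special block of E(S₃(m)), whose letters R₁, …, R_m appear after that block in this order, and such that between that special block and R₁, and between R_i and R_{i+1} for each 1 ≤ i ≤ m−1, there lies at least one complete special block of E(S₃(m)) consisting of letters of symbols other than 1, …, m. -/

import Mathlib

/-! ### Sequences with special blocks, encoded as token lists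

A sequence with special blocks is encoded as a list of tokens: `Tok.sym a` is an
occurrence of the symbol `a`, and `Tok.op` / `Tok.cl` are the opening and closing
parentheses delimiting the special blocks. -/

/-- Tokens of a symbol sequence with special blocks. -/
inductive Tok : Type where
  | sym : ℕ → Tok
  | op : Tok
  | cl : Tok
deriving DecidableEq, Repr

/-- Tokens of an endpoint sequence with special blocks: `L a` / `R a` are the
left/right endpoint letters of the symbol `a`, and `op`/`cl` delimit blocks. -/
inductive ETok : Type where
  | L : ℕ → ETok
  | R : ℕ → ETok
  | op : ETok
  | cl : ETok
deriving DecidableEq, Repr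

/-- Fresh relabeling of the symbols of the `i`-th local copy. -/
def loc (i a : ℕ) : ℕ := 2 * Nat.pair i a

/-- Relabeling of the global symbols. -/
def glob (a : ℕ) : ℕ := 2 * a + 1

/-- The underlying sequence of symbols of a token list (parentheses dropped). -/
def symsOf : List Tok → List ℕ
  | [] => []
  | Tok.sym a :: r => a :: symsOf r
  | _ :: r => symsOf r

/-- Read a special block: the symbols up to (and excluding) the next closing
parenthesis, together with the remainder of the list after that parenthesis. -/
def takeBlock : List Tok → List ℕ × List Tok
  | [] => ([], [])
  | Tok.cl :: r => ([], r)
  | Tok.sym a :: r => ((takeBlock r).1.cons a, (takeBlock r).2)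
  | Tok.op :: r => takeBlock r

theorem takeBlock_len : ∀ l : List Tok, (takeBlock l).2.length ≤ l.length := by
  intro l
  induction l with
  | nil => simp [takeBlock]
  | cons t r ih => cases t <;> simp [takeBlock] <;> omega

/-- Auxiliary function for the shuffle `A • B`: traverse the `i`-th fresh copy of
`A` (relabeling its symbols by `loc i`), inserting the next global symbol of the
list `ins` (relabeled by `glob`) at the end of each special block and duplicating
the previously last symbol of that block immediately after the block.  The third
argument remembers the (relabeled) last symbol seen. -/
def copyIns (i : ℕ) : List Tok → List ℕ → Option ℕ → List Tok
  | [], _, _ => []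
  | Tok.sym a :: r, ins, _ => Tok.sym (loc i a) :: copyIns i r ins (some (loc i a))
  | Tok.op :: r, ins, p => Tok.op :: copyIns i r ins p
  | Tok.cl :: r, b :: ins, some q =>
      Tok.sym (glob b) :: Tok.cl :: Tok.sym q :: copyIns i r ins (some q)
  | Tok.cl :: r, ins, p => Tok.cl :: copyIns i r ins p

/-- The modified copy `Aᵢ'` of `A` used in the shuffle `A • B`: the symbols of the
`i`-th special block `blk` of `B` are inserted into the special blocks of the copy,
and another copy of the last symbol of `blk` is appended at the very end. -/
def copyA (i : ℕ) (A : List Tok) (blk : List ℕ) : List Tok :=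
  copyIns i A blk none ++ (blk.getLast?.elim [] fun a => [Tok.sym (glob a)])

/-- Auxiliary function for the shuffle: traverse `B` (relabeling its symbols by
`glob`), replacing its `i`-th special block by the modified `i`-th copy of `A`. -/
def bulletAux (A : List Tok) : ℕ → List Tok → List Tok
  | _, [] => []
  | i, Tok.op :: r => copyA i A (takeBlock r).1 ++ bulletAux A (i + 1) (takeBlock r).2
  | i, Tok.sym a :: r => Tok.sym (glob a) :: bulletAux A i r
  | i, Tok.cl :: r => Tok.cl :: bulletAux A i r
termination_by _ l => l.length
decreasing_by
  · exact Nat.lt_succ_of_le (takeBlock_len r)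
  · exact Nat.lt_succ_self _
  · exact Nat.lt_succ_self _

/-- The shuffle `A • B` of two sequences with special blocks. -/
def bullet (A B : List Tok) : List Tok := bulletAux A 0 B

/-- Split each special block of length 2 into two special blocks of length 1. -/
def split2 : List Tok → List Tok
  | Tok.op :: Tok.sym a :: Tok.sym b :: Tok.cl :: r =>
      Tok.op :: Tok.sym a :: Tok.cl :: Tok.op :: Tok.sym b :: Tok.cl :: split2 r
  | t :: r => t :: split2 r
  | [] => []

/-- The Hart–Sharir sequence `S₁(m) = (1 2 ⋯ m) (m−1) ⋯ 2 1 2 ⋯ m`,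
with a single special block `(1 2 ⋯ m)`. -/
def S1 (m : ℕ) : List Tok :=
  Tok.op :: ((List.range' 1 m).map Tok.sym) ++ Tok.cl ::
    (((List.range' 1 (m - 1)).reverse.map Tok.sym) ++ ((List.range' 2 (m - 1)).map Tok.sym))

/-- The number of special blocks of a token sequence. -/
def numBlocks (S : List Tok) : ℕ := S.count Tok.op

/-- The Hart–Sharir sequences `S_k(m)`, defined by double recursion:
`S₁(m)` is the `N`-shaped sequence above; for `k ≥ 2`, `S_k(1)` is `S_{k−1}(2)` with
each special block of length 2 split into two special blocks of length 1; and for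
`k, m ≥ 2`, `S_k(m) = S_k(m−1) • S_{k−1}(N)` where `N` is the number of special
blocks of `S_k(m−1)`.  (The value for `k = 0` or `m = 0` is junk.) -/
def HS : ℕ → ℕ → List Tok
  | 0, _ => []
  | 1, m => S1 m
  | _ + 2, 0 => []
  | k + 2, 1 => split2 (HS (k + 1) 2)
  | k + 2, m + 2 => bullet (HS (k + 2) (m + 1)) (HS (k + 1) (numBlocks (HS (k + 2) (m + 1))))
termination_by k m => (k, m)



/-- The list of special blocks of a token sequence (each block as its list of symbols). -/
def blocksOf : List Tok → List (List ℕ)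
  | [] => []
  | Tok.op :: r => (takeBlock r).1 :: blocksOf (takeBlock r).2
  | _ :: r => blocksOf r
termination_by l => l.length
decreasing_by
  · exact Nat.lt_succ_of_le (takeBlock_len r)
  · exact Nat.lt_succ_self _

/-- The rank of a symbol: the position (counting from 1) that its first occurrence
occupies within its special block (`0` if the symbol lies in no special block). -/
def rankOf (S : List Tok) (a : ℕ) : ℕ :=
  match (blocksOf S).find? (fun b => decide (a ∈ b)) with
  | some b => b.idxOf a + 1
  | none => 0

/-- Two symbols have their first occurrences in the same special block. -/
def SameBlock (S : List Tok) (a b : ℕ) : Prop :=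
  ∃ blk ∈ blocksOf S, a ∈ blk ∧ b ∈ blk

/-- The symbol `a` is left-clamped in the sequence `s`: `s` contains the
subsequence `b a b a`, where `b` is the symbol immediately preceding the first
occurrence of `a` in `s`. -/
def LeftClamped (s : List ℕ) (a : ℕ) : Prop :=
  ∃ (u v : List ℕ) (b : ℕ), s = u ++ b :: a :: v ∧ a ∉ u ∧ b ≠ a ∧
    [b, a, b, a].Sublist s

/-- The symbol `a` is right-clamped in the sequence `s`: `s` contains the
subsequence `a b a b`, where `b` is the symbol immediately following the last
occurrence of `a` in `s`. -/
def RightClamped (s : List ℕ) (a : ℕ) : Prop :=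
  ∃ (u v : List ℕ) (b : ℕ), s = u ++ a :: b :: v ∧ a ∉ v ∧ b ≠ a ∧
    [a, b, a, b].Sublist s

/-- Auxiliary function for the endpoint sequence: the first argument collects the
symbols already seen.  The first occurrence of each symbol becomes an `L` letter,
its last occurrence becomes an `R` letter, all other occurrences are deleted, and
parentheses are kept. -/
def EAux : List ℕ → List Tok → List ETok
  | _, [] => []
  | seen, Tok.op :: r => ETok.op :: EAux seen r
  | seen, Tok.cl :: r => ETok.cl :: EAux seen r
  | seen, Tok.sym a :: r =>
      if a ∈ seen then
        if a ∈ symsOf r then EAux seen r else ETok.R a :: EAux seen r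
      else ETok.L a :: EAux (a :: seen) r

/-- The endpoint sequence `E(S)` of a sequence with special blocks. -/
def Efun (S : List Tok) : List ETok := EAux [] S

/-- Read a special block of an endpoint sequence: the labels of the `L` letters up
to the next closing parenthesis, and the remainder of the list after it. -/
def takeBlockE : List ETok → List ℕ × List ETok
  | [] => ([], [])
  | ETok.cl :: r => ([], r)
  | ETok.L a :: r => ((takeBlockE r).1.cons a, (takeBlockE r).2)
  | _ :: r => takeBlockE r

theorem takeBlockE_len : ∀ l : List ETok, (takeBlockE l).2.length ≤ l.length := by
  intro l
  induction l with
  | nil => simp [takeBlockE]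
  | cons t r ih => cases t <;> simp [takeBlockE] <;> omega

/-- Auxiliary function for the endpoint shuffle `A ∘ B`: traverse the `i`-th fresh
copy of `A` (relabeling by `loc i`), inserting the next left-endpoint letter of the
list `ins` (relabeled by `glob`) at the end of each special block. -/
def ecopyIns (i : ℕ) : List ETok → List ℕ → List ETok
  | [], _ => []
  | ETok.L a :: r, ins => ETok.L (loc i a) :: ecopyIns i r ins
  | ETok.R a :: r, ins => ETok.R (loc i a) :: ecopyIns i r ins
  | ETok.op :: r, ins => ETok.op :: ecopyIns i r ins
  | ETok.cl :: r, b :: ins => ETok.L (glob b) :: ETok.cl :: ecopyIns i r ins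
  | ETok.cl :: r, [] => ETok.cl :: ecopyIns i r []

/-- Auxiliary function for the endpoint shuffle: traverse `B` (relabeling by
`glob`), replacing its `i`-th special block by the `i`-th modified copy of `A`. -/
def eshufAux (A : List ETok) : ℕ → List ETok → List ETok
  | _, [] => []
  | i, ETok.op :: r => ecopyIns i A (takeBlockE r).1 ++ eshufAux A (i + 1) (takeBlockE r).2
  | i, ETok.L a :: r => ETok.L (glob a) :: eshufAux A i r
  | i, ETok.R a :: r => ETok.R (glob a) :: eshufAux A i r
  | i, ETok.cl :: r => ETok.cl :: eshufAux A i r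
termination_by _ l => l.length
decreasing_by
  · exact Nat.lt_succ_of_le (takeBlockE_len r)
  · exact Nat.lt_succ_self _
  · exact Nat.lt_succ_self _
  · exact Nat.lt_succ_self _

/-- The endpoint shuffle `A ∘ B` of two endpoint sequences with special blocks. -/
def eshuffle (A B : List ETok) : List ETok := eshufAux A 0 B

/-- The token list is a well-formed sequence with special blocks: a concatenation
of symbols and of parenthesized blocks consisting only of symbols. -/
inductive Blocked : List Tok → Prop
  | nil : Blocked []
  | sym (a : ℕ) {l : List Tok} : Blocked l → Blocked (Tok.sym a :: l)
  | blk (b : List ℕ) {l : List Tok} :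
      Blocked l → Blocked (Tok.op :: b.map Tok.sym ++ Tok.cl :: l)

/-- The special blocks of `S` contain only first occurrences of symbols, and every
symbol of `S` makes its first occurrence inside a special block. -/
def FirstOccBlocks (S : List Tok) : Prop :=
  (∀ (u b v : List Tok), S = u ++ Tok.op :: b ++ Tok.cl :: v →
      ∀ a : ℕ, Tok.sym a ∈ b → a ∉ symsOf u ∧ (symsOf b).count a = 1) ∧
  (∀ a ∈ symsOf S, ∃ (u b v : List Tok),
      S = u ++ Tok.op :: b ++ Tok.cl :: v ∧ Tok.sym a ∈ b ∧ a ∉ symsOf u)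

/-- Concatenations of symbols and of nonempty parenthesized blocks of symbols. -/
inductive BlockSeq : List Tok → Prop
  | nil : BlockSeq []
  | sym (a : ℕ) {l : List Tok} : BlockSeq l → BlockSeq (Tok.sym a :: l)
  | blk {b : List ℕ} (hb : b ≠ []) {l : List Tok} :
      BlockSeq l → BlockSeq (Tok.op :: (b.map Tok.sym ++ Tok.cl :: l))

theorem BlockSeq.append {u v : List Tok} (hu : BlockSeq u) (hv : BlockSeq v) :
    BlockSeq (u ++ v) := by
  induction hu with
  | nil => exact hv
  | sym a _ ih => exact .sym a ih
  | blk hb _ ih => simpa using BlockSeq.blk hb ih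

theorem BlockSeq.map_sym (w : List ℕ) : BlockSeq (w.map Tok.sym) := by
  induction w with
  | nil => exact .nil
  | cons a w ih => exact .sym a ih

theorem count_op_map_sym (w : List ℕ) : (w.map Tok.sym).count Tok.op = 0 := by
  simp [List.count_eq_zero]

theorem count_cl_map_sym (w : List ℕ) : (w.map Tok.sym).count Tok.cl = 0 := by
  simp [List.count_eq_zero]

theorem BlockSeq.count_op {u : List Tok} (hu : BlockSeq u) :
    u.count Tok.op = u.count Tok.cl := by
  induction hu with
  | nil => rfl
  | sym a _ ih => simpa [List.count_cons] using ih
  | blk hb _ ih =>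
    simp [List.count_append, count_op_map_sym, count_cl_map_sym, ih]

theorem symsOf_append (u v : List Tok) : symsOf (u ++ v) = symsOf u ++ symsOf v := by
  induction u with
  | nil => rfl
  | cons t u ih => cases t <;> simp [symsOf, ih]

theorem symsOf_map_sym (w : List ℕ) : symsOf (w.map Tok.sym) = w := by
  induction w with
  | nil => rfl
  | cons a w ih => simp [symsOf, ih]

theorem takeBlock_block (b : List ℕ) (r : List Tok) :
    takeBlock (b.map Tok.sym ++ Tok.cl :: r) = (b, r) := by
  induction b with
  | nil => rfl
  | cons a b ih => simp [takeBlock, ih]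

theorem loc_ne_glob (i a b : ℕ) : loc i a ≠ glob b := by
  unfold loc glob
  omega

theorem glob_injective : Function.Injective glob := fun a b h => by
  unfold glob at h
  omega

theorem loc_inj {i a j b : ℕ} : loc i a = loc j b ↔ i = j ∧ a = b := by
  unfold loc
  rw [Nat.mul_left_cancel_iff (by norm_num), Nat.pair_eq_pair]

theorem loc_injective (i : ℕ) : Function.Injective (loc i) := fun _ _ h => (loc_inj.1 h).2

theorem copyIns_map_sym (i : ℕ) (w : List ℕ) (y : List Tok) (ins : List ℕ) (p : Option ℕ) :
    ∃ p', copyIns i (w.map Tok.sym ++ y) ins p =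
      (w.map (loc i)).map Tok.sym ++ copyIns i y ins p' := by
  induction w generalizing p with
  | nil => exact ⟨p, rfl⟩
  | cons a w ih =>
    obtain ⟨p', h⟩ := ih (some (loc i a))
    exact ⟨p', by simpa [copyIns] using h⟩

/-- The effect of `copyIns` on a nonempty special block. -/
theorem copyIns_block (i : ℕ) {b : List ℕ} (hb : b ≠ []) (l : List Tok) (ins : List ℕ)
    (p : Option ℕ) :
    copyIns i (Tok.op :: (b.map Tok.sym ++ Tok.cl :: l)) ins p =
      Tok.op :: ((b.map (loc i) ++ (ins.take 1).map glob).map Tok.sym ++ Tok.cl ::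
        (((ins.take 1).map fun _ => loc i (b.getLast hb)).map Tok.sym ++
          copyIns i l (ins.drop 1) (some (loc i (b.getLast hb))))) := by
  have key : ∀ (b : List ℕ) (hb : b ≠ []) (p : Option ℕ),
      copyIns i (b.map Tok.sym ++ Tok.cl :: l) ins p =
      ((b.map (loc i) ++ (ins.take 1).map glob).map Tok.sym ++ Tok.cl ::
        (((ins.take 1).map fun _ => loc i (b.getLast hb)).map Tok.sym ++
          copyIns i l (ins.drop 1) (some (loc i (b.getLast hb))))) := by
    intro b
    induction b with
    | nil => exact fun h => absurd rfl h
    | cons a b ih =>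
      intro _ p
      rcases eq_or_ne b [] with rfl | hb'
      · cases ins <;> simp [copyIns]
      · simpa [copyIns, List.getLast_cons hb'] using ih hb' (some (loc i a))
  simpa [copyIns] using key b hb p

theorem copyIns_append (i : ℕ) {u : List Tok} (hu : BlockSeq u) (ins : List ℕ) (p : Option ℕ) :
    ∃ p', ∀ y, copyIns i (u ++ y) ins p =
      copyIns i u ins p ++ copyIns i y (ins.drop (u.count Tok.cl)) p' := by
  induction hu generalizing ins p with
  | nil => exact ⟨p, fun y => by simp [copyIns]⟩
  | sym a _ ih =>
    obtain ⟨p', h⟩ := ih ins (some (loc i a))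
    exact ⟨p', fun y => by simpa [copyIns, List.count_cons] using h y⟩
  | @blk b hb l _ ih =>
    obtain ⟨p', h⟩ := ih (ins.drop 1) (some (loc i (b.getLast hb)))
    refine ⟨p', fun y => ?_⟩
    have hl : (Tok.op :: (b.map Tok.sym ++ Tok.cl :: l)) ++ y =
        Tok.op :: (b.map Tok.sym ++ Tok.cl :: (l ++ y)) := by simp
    rw [hl, copyIns_block i hb, copyIns_block i hb, h]
    simp [List.count_append, count_cl_map_sym]

theorem BlockSeq.copyIns (i : ℕ) {u : List Tok} (hu : BlockSeq u) (ins : List ℕ)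
    (p : Option ℕ) : BlockSeq (copyIns i u ins p) := by
  induction hu generalizing ins p with
  | nil => simpa [_root_.copyIns] using BlockSeq.nil
  | sym a _ ih => simpa [_root_.copyIns] using BlockSeq.sym _ (ih _ _)
  | blk hb _ ih =>
    rw [copyIns_block i hb]
    exact .blk (by simp [hb]) ((BlockSeq.map_sym _).append (ih _ _))

theorem mem_symsOf_copyIns (i : ℕ) {u : List Tok} (hu : BlockSeq u) (ins : List ℕ)
    (p : Option ℕ) {x : ℕ} (hx : x ∈ symsOf (copyIns i u ins p)) :
    (∃ a ∈ symsOf u, x = loc i a) ∨ ∃ c ∈ ins.take (u.count Tok.cl), x = glob c := by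
  induction hu generalizing ins p with
  | nil => simp [copyIns, symsOf] at hx
  | sym a _ ih =>
    simp only [copyIns, symsOf, List.mem_cons] at hx ⊢
    rcases hx with rfl | hx
    · exact .inl ⟨a, .inl rfl, rfl⟩
    · rcases ih _ _ hx with ⟨c, hc, rfl⟩ | ⟨c, hc, rfl⟩
      · exact .inl ⟨c, .inr hc, rfl⟩
      · exact .inr ⟨c, by simpa [List.count_cons] using hc, rfl⟩
  | @blk b hb l _ ih =>
    have hcount : (Tok.op :: (b.map Tok.sym ++ Tok.cl :: l)).count Tok.cl =
        1 + l.count Tok.cl := by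
      simp [List.count_append, count_cl_map_sym, Nat.add_comm]
    rw [copyIns_block i hb] at hx
    simp only [symsOf, symsOf_append, symsOf_map_sym, List.mem_append, List.mem_map] at hx ⊢
    rw [hcount, List.take_add]
    simp only [List.mem_append]
    rcases hx with (⟨c, hc, rfl⟩ | ⟨c, hc, rfl⟩) | ⟨_, _, rfl⟩ | hx
    · exact .inl ⟨c, .inl hc, rfl⟩
    · exact .inr ⟨c, .inl hc, rfl⟩
    · exact .inl ⟨_, .inl (List.getLast_mem hb), rfl⟩
    · rcases ih _ _ hx with ⟨c, hc, rfl⟩ | ⟨c, hc, rfl⟩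
      · exact .inl ⟨c, .inr hc, rfl⟩
      · exact .inr ⟨c, .inr hc, rfl⟩

theorem bulletAux_map_sym (A : List Tok) (i : ℕ) (w : List ℕ) (y : List Tok) :
    bulletAux A i (w.map Tok.sym ++ y) = (w.map glob).map Tok.sym ++ bulletAux A i y := by
  induction w with
  | nil => rfl
  | cons a w ih => simpa [bulletAux] using ih

theorem bulletAux_block (A : List Tok) (i : ℕ) (b : List ℕ) (y : List Tok) :
    bulletAux A i (Tok.op :: (b.map Tok.sym ++ Tok.cl :: y)) =
      copyIns i A b none ++ ((b.getLast?.toList.map glob).map Tok.sym ++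
        bulletAux A (i + 1) y) := by
  rw [bulletAux, takeBlock_block]
  cases h : b.getLast? <;> simp [copyA, h]

/-- The token list `(α) w (β) z`, with `w` and `z` outside of the special blocks. -/
def twoBlocks (α w β z : List ℕ) : List Tok :=
  Tok.op :: (α.map Tok.sym ++ Tok.cl :: (w.map Tok.sym ++
    Tok.op :: (β.map Tok.sym ++ Tok.cl :: z.map Tok.sym)))

theorem numBlocks_twoBlocks (α w β z : List ℕ) : numBlocks (twoBlocks α w β z) = 2 := by
  simp [numBlocks, twoBlocks, List.count_append, count_op_map_sym]

theorem bullet_twoBlocks (A : List Tok) (α w β z : List ℕ) :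
    bullet A (twoBlocks α w β z) =
      copyIns 0 A α none ++ (((α.getLast?.toList ++ w).map glob).map Tok.sym ++
        (copyIns 1 A β none ++ ((β.getLast?.toList ++ z).map glob).map Tok.sym)) := by
  have hz := bulletAux_map_sym A 2 z []
  simp only [List.append_nil] at hz
  rw [bullet, twoBlocks, bulletAux_block, bulletAux_map_sym, bulletAux_block, hz]
  simp [bulletAux]

theorem HS_two_one : HS 2 1 = twoBlocks [1] [] [2] [1, 2] := by
  simp [HS, S1, split2, twoBlocks, List.range'_succ]

theorem bullet_S1_two (A : List Tok) :
    bullet A (S1 2) = copyIns 0 A [1, 2] none ++ [5, 3, 5].map Tok.sym := by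
  have h : S1 2 = Tok.op :: ([1, 2].map Tok.sym ++ Tok.cl :: ([1, 2].map Tok.sym ++ [])) := rfl
  rw [bullet, h, bulletAux_block, bulletAux_map_sym]
  simp [bulletAux, glob]

theorem copyIns_twoBlocks (i : ℕ) {α β : List ℕ} (hα : α ≠ []) (hβ : β ≠ []) (w z : List ℕ)
    (a b : ℕ) :
    copyIns i (twoBlocks α w β z) [a, b] none =
      twoBlocks (α.map (loc i) ++ [glob a]) (loc i (α.getLast hα) :: w.map (loc i))
        (β.map (loc i) ++ [glob b]) (loc i (β.getLast hβ) :: z.map (loc i)) := by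
  obtain ⟨p, hp⟩ := copyIns_map_sym i w
    (Tok.op :: (β.map Tok.sym ++ Tok.cl :: z.map Tok.sym)) [b] (some (loc i (α.getLast hα)))
  obtain ⟨p', hp'⟩ := copyIns_map_sym i z [] [] (some (loc i (β.getLast hβ)))
  simp only [List.append_nil] at hp'
  rw [twoBlocks, copyIns_block i hα]
  simp only [List.drop_succ_cons, List.drop_zero]
  rw [hp, copyIns_block i hβ]
  simp only [List.drop_succ_cons, List.drop_zero]
  rw [hp']
  simp [twoBlocks, copyIns]

theorem twoBlocks_append_map_sym (α w β z y : List ℕ) :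
    twoBlocks α w β z ++ y.map Tok.sym = twoBlocks α w β (z ++ y) := by
  simp [twoBlocks]

/-- `S₂(N)` has two special blocks, and every symbol of the first one recurs after the
second one. -/
theorem exists_HS_two_eq (n : ℕ) : ∃ α w β z : List ℕ,
    HS 2 (n + 1) = twoBlocks α w β z ∧ α.length = n + 1 ∧ β ≠ [] ∧ α.Nodup ∧
      List.Disjoint α β ∧ ∀ a ∈ α, a ∈ z := by
  induction n with
  | zero => exact ⟨[1], [], [2], [1, 2], HS_two_one, by simp⟩
  | succ n ih =>
    obtain ⟨α, w, β, z, h, hlen, hβ, hnd, hdis, hz⟩ := ih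
    have hα : α ≠ [] := by
      rintro rfl
      simp at hlen
    refine ⟨α.map (loc 0) ++ [glob 1], loc 0 (α.getLast hα) :: w.map (loc 0),
      β.map (loc 0) ++ [glob 2], loc 0 (β.getLast hβ) :: z.map (loc 0) ++ [5, 3, 5],
      ?_, by simp [hlen], by simp, ?_, ?_, ?_⟩
    · rw [HS, h, numBlocks_twoBlocks, HS, bullet_S1_two, copyIns_twoBlocks 0 hα hβ,
        twoBlocks_append_map_sym]
    · rw [List.nodup_append]
      refine ⟨hnd.map (loc_injective 0), by simp, ?_⟩
      intro x hx y hy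
      obtain ⟨c, -, rfl⟩ := List.mem_map.1 hx
      rw [List.mem_singleton.1 hy]
      exact loc_ne_glob _ _ _
    · intro x hx hy
      simp only [List.mem_append, List.mem_map, List.mem_singleton] at hx hy
      rcases hx with ⟨c, hc, rfl⟩ | rfl
      · rcases hy with ⟨d, hd, hcd⟩ | hcd
        · exact hdis hc (loc_injective 0 hcd ▸ hd)
        · exact loc_ne_glob _ _ _ hcd
      · rcases hy with ⟨d, hd, hcd⟩ | hcd
        · exact loc_ne_glob _ _ _ hcd
        · exact absurd (glob_injective hcd) (by norm_num)
    · intro x hx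
      simp only [List.mem_append, List.mem_map, List.mem_singleton] at hx
      rcases hx with ⟨c, hc, rfl⟩ | rfl
      · have := hz c hc
        simp only [List.cons_append, List.mem_cons, List.mem_append, List.mem_map]
        exact .inr (.inl ⟨c, this, rfl⟩)
      · simp [glob]

/-- The last occurrences of the symbols of a list appear in a token list in this order, each
one preceded (after the previous one) by a special block avoiding `all`. -/
def LastOccs (all : List ℕ) : List ℕ → List Tok → Prop
  | [], T => BlockSeq T
  | a :: l, T => ∃ (u : List Tok) (b : List ℕ) (v T' : List Tok),
      T = u ++ Tok.op :: (b.map Tok.sym ++ Tok.cl :: (v ++ Tok.sym a :: T')) ∧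
      BlockSeq u ∧ b ≠ [] ∧ BlockSeq v ∧ (∀ x ∈ b, x ∉ all) ∧ a ∉ symsOf T' ∧
      LastOccs all l T'

theorem LastOccs.blockSeq {all l : List ℕ} {T : List Tok} (h : LastOccs all l T) :
    BlockSeq T := by
  induction l generalizing T with
  | nil => exact h
  | cons a l ih =>
    obtain ⟨u, b, v, T', rfl, hu, hb, hv, -, -, hT'⟩ := h
    exact hu.append (.blk hb (hv.append (.sym a (ih hT'))))

theorem LastOccs.append_left {all l : List ℕ} {g T : List Tok} (hg : BlockSeq g)
    (h : LastOccs all l T) : LastOccs all l (g ++ T) := by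
  cases l with
  | nil => exact hg.append h
  | cons a l =>
    obtain ⟨u, b, v, T', rfl, hu, hrest⟩ := h
    exact ⟨g ++ u, b, v, T', by simp, hg.append hu, hrest⟩

theorem LastOccs.copyIns {all l : List ℕ} {T : List Tok} (h : LastOccs all l T) {a : ℕ}
    {ins : List ℕ} (ha : a ∉ ins) (p : Option ℕ) {K : List Tok}
    (hK : LastOccs (all.map (loc 0) ++ [glob a]) [glob a] K)
    (hKloc : ∀ x, loc 0 x ∉ symsOf K) :
    LastOccs (all.map (loc 0) ++ [glob a]) (l.map (loc 0) ++ [glob a])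
      (copyIns 0 T ins p ++ K) := by
  induction l generalizing T ins p with
  | nil => exact hK.append_left (BlockSeq.copyIns 0 h ins p)
  | cons c l ih =>
    obtain ⟨u, b, v, T', rfl, hu, hb, hv, hball, hc, hT'⟩ := h
    obtain ⟨p₁, h₁⟩ := copyIns_append 0 hu ins p
    obtain ⟨p₂, h₂⟩ := copyIns_append 0 hv ((ins.drop (u.count Tok.cl)).drop 1)
      (some (loc 0 (b.getLast hb)))
    rw [h₁, copyIns_block 0 hb, h₂]
    set ins₁ := ins.drop (u.count Tok.cl) with hins₁
    set ins₂ := (ins₁.drop 1).drop (v.count Tok.cl) with hins₂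
    have hsub₁ : ∀ x ∈ ins₁, x ∈ ins := fun x hx => List.mem_of_mem_drop hx
    have hsub₂ : ∀ x ∈ ins₂, x ∈ ins := fun x hx =>
      hsub₁ x (List.mem_of_mem_drop (List.mem_of_mem_drop hx))
    refine ⟨_root_.copyIns 0 u ins p, b.map (loc 0) ++ (ins₁.take 1).map glob,
      ((ins₁.take 1).map fun _ => loc 0 (b.getLast hb)).map Tok.sym ++
        _root_.copyIns 0 v (ins₁.drop 1) (some (loc 0 (b.getLast hb))),
      _root_.copyIns 0 T' ins₂ (some (loc 0 c)) ++ K, by simp [_root_.copyIns],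
      hu.copyIns 0 _ _, by simp [hb], (BlockSeq.map_sym _).append (hv.copyIns 0 _ _), ?_, ?_,
      ih hT' (fun h => ha (hsub₂ _ h)) _⟩
    · intro x hx hall
      simp only [List.mem_append, List.mem_map, List.mem_singleton] at hx hall
      rcases hx with ⟨d, hd, rfl⟩ | ⟨d, hd, rfl⟩
      · rcases hall with ⟨e, he, hed⟩ | hall
        · exact hball d hd (loc_injective 0 hed ▸ he)
        · exact loc_ne_glob _ _ _ hall
      · rcases hall with ⟨e, he, hed⟩ | hall
        · exact loc_ne_glob _ _ _ hed
        · exact ha (glob_injective hall ▸ hsub₁ d (List.mem_of_mem_take hd))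
    · rw [symsOf_append, List.mem_append]
      rintro (hx | hx)
      · rcases mem_symsOf_copyIns 0 hT'.blockSeq _ _ hx with ⟨d, hd, hcd⟩ | ⟨d, -, hcd⟩
        · exact hc (loc_injective 0 hcd ▸ hd)
        · exact loc_ne_glob _ _ _ hcd
      · exact hKloc c hx

/-- The pattern `(s₁ ⋯ s_m) ( ) s₁ ( ) s₂ ⋯ ( ) s_m` at the level of symbol sequences: the block
consists of first occurrences, the later letters are last occurrences. -/
def HasPattern (m : ℕ) (A : List Tok) : Prop :=
  ∃ (s : List ℕ) (u T : List Tok), s.length = m ∧ s.Nodup ∧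
    A = u ++ Tok.op :: (s.map Tok.sym ++ Tok.cl :: T) ∧ BlockSeq u ∧
    (∀ x ∈ s, x ∉ symsOf u) ∧ LastOccs s s T

theorem exists_eq_append_cons_notMem {a : ℕ} {z : List ℕ} (h : a ∈ z) :
    ∃ z₁ z₂, z = z₁ ++ a :: z₂ ∧ a ∉ z₂ := by
  obtain ⟨z₁, z₂, hz, hn⟩ := List.eq_append_cons_of_mem (List.mem_reverse.2 h)
  refine ⟨z₂.reverse, z₁.reverse, ?_, by simpa using hn⟩
  rw [← List.reverse_reverse z, hz]
  simp

theorem HasPattern.bullet {m : ℕ} (hm : 1 ≤ m) {A : List Tok} (h : HasPattern m A)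
    {α w β z : List ℕ} (hlen : α.length = numBlocks A) (hnd : α.Nodup)
    (hdis : List.Disjoint α β) (hz : ∀ a ∈ α, a ∈ z) :
    HasPattern (m + 1) (bullet A (twoBlocks α w β z)) := by
  obtain ⟨s, u, T, hs, hsnd, hA, hu, hsu, hT⟩ := h
  have hs0 : s ≠ [] := by
    rintro rfl
    simp at hs
    omega
  have hAB : BlockSeq A := hA ▸ hu.append (.blk hs0 hT.blockSeq)
  have hk : u.count Tok.cl < α.length := by
    rw [hlen, numBlocks, hAB.count_op, hA]
    simp [List.count_append]
  set k := u.count Tok.cl with hkdef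
  have hdrop : α.drop k = α[k] :: α.drop (k + 1) := List.drop_eq_getElem_cons hk
  set a := α[k] with ha
  have hα : α = α.take k ++ a :: α.drop (k + 1) := by rw [← hdrop, List.take_append_drop]
  have hnd' := hnd
  rw [hα, List.nodup_middle, List.nodup_cons, List.mem_append, not_or] at hnd'
  obtain ⟨⟨ha₁, ha₂⟩, -⟩ := hnd'
  have haα : a ∈ α := List.getElem_mem hk
  obtain ⟨z₁, z₂, rfl, haz⟩ := exists_eq_append_cons_notMem (hz a haα)
  set q := loc 0 (s.getLast hs0) with hq
  obtain ⟨p₀, h₀⟩ := copyIns_append 0 hu α none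
  obtain ⟨p₁, h₁⟩ := copyIns_append 1 hu β none
  have hcopy₀ : copyIns 0 A α none = copyIns 0 u α none ++
      Tok.op :: ((s.map (loc 0) ++ [glob a]).map Tok.sym ++ Tok.cl ::
        Tok.sym q :: copyIns 0 T (α.drop (k + 1)) (some q)) := by
    rw [hA, h₀, copyIns_block 0 hs0, hdrop]
    simp [hq]
  set β₁ := β.drop k with hβ₁
  have hβsub : ∀ x ∈ β₁.take 1, x ∈ β := fun x hx =>
    List.mem_of_mem_drop (List.mem_of_mem_take hx)
  have hcopy₁ : copyIns 1 A β none = copyIns 1 u β none ++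
      Tok.op :: ((s.map (loc 1) ++ (β₁.take 1).map glob).map Tok.sym ++ Tok.cl ::
        (((β₁.take 1).map fun _ => loc 1 (s.getLast hs0)).map Tok.sym ++
          copyIns 1 T (β₁.drop 1) (some (loc 1 (s.getLast hs0))))) := by
    rw [hA, h₁, copyIns_block 1 hs0]
  set K : List Tok := ((α.getLast?.toList ++ w).map glob).map Tok.sym ++
        (copyIns 1 A β none ++
          ((β.getLast?.toList ++ (z₁ ++ a :: z₂)).map glob).map Tok.sym) with hKdef
  have hKloc : ∀ x, loc 0 x ∉ symsOf K := by
    intro x hx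
    simp only [hKdef, symsOf_append, symsOf_map_sym] at hx
    rw [List.mem_append, List.mem_append] at hx
    rcases hx with hx | hx | hx
    · obtain ⟨c, -, hc⟩ := List.mem_map.1 hx
      exact loc_ne_glob _ _ _ hc.symm
    · rcases mem_symsOf_copyIns 1 hAB _ _ hx with ⟨c, -, hc⟩ | ⟨c, -, hc⟩
      · exact absurd (loc_inj.1 hc).1 (by norm_num)
      · exact loc_ne_glob _ _ _ hc
    · obtain ⟨c, -, hc⟩ := List.mem_map.1 hx
      exact loc_ne_glob _ _ _ hc.symm
  have hK : LastOccs (s.map (loc 0) ++ [glob a]) [glob a] K := by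
    refine LastOccs.append_left (BlockSeq.map_sym _)
      ⟨copyIns 1 u β none, s.map (loc 1) ++ (β₁.take 1).map glob,
      (((β₁.take 1).map fun _ => loc 1 (s.getLast hs0)).map Tok.sym ++
          copyIns 1 T (β₁.drop 1) (some (loc 1 (s.getLast hs0)))) ++
        ((β.getLast?.toList ++ z₁).map glob).map Tok.sym,
      (z₂.map glob).map Tok.sym, ?_, hu.copyIns 1 _ _, by simp [hs0],
      ((BlockSeq.map_sym _).append (hT.blockSeq.copyIns 1 _ _)).append (BlockSeq.map_sym _),
      ?_, ?_, BlockSeq.map_sym _⟩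
    · rw [hcopy₁]
      simp
    · intro x hx hall
      simp only [List.mem_append, List.mem_map, List.mem_singleton] at hx hall
      rcases hx with ⟨d, hd, rfl⟩ | ⟨d, hd, rfl⟩
      · rcases hall with ⟨e, he, hed⟩ | hall
        · exact absurd (loc_inj.1 hed).1 (by norm_num)
        · exact loc_ne_glob _ _ _ hall
      · rcases hall with ⟨e, he, hed⟩ | hall
        · exact loc_ne_glob _ _ _ hed
        · exact hdis haα (glob_injective hall ▸ hβsub d hd)
    · rw [symsOf_map_sym, List.mem_map_of_injective glob_injective]
      exact haz
  refine ⟨s.map (loc 0) ++ [glob a], copyIns 0 u α none,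
    [q].map Tok.sym ++ (copyIns 0 T (α.drop (k + 1)) (some q) ++ K), by simp [hs], ?_, ?_,
    hu.copyIns 0 _ _, ?_, (hT.copyIns ha₂ _ hK hKloc).append_left (BlockSeq.map_sym _)⟩
  · rw [List.nodup_append]
    refine ⟨hsnd.map (loc_injective 0), by simp, ?_⟩
    intro x hx y hy
    obtain ⟨c, -, rfl⟩ := List.mem_map.1 hx
    rw [List.mem_singleton.1 hy]
    exact loc_ne_glob _ _ _
  · rw [bullet_twoBlocks, hcopy₀]
    simp [hKdef]
  · intro x hx hxu
    simp only [List.mem_append, List.mem_map, List.mem_singleton] at hx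
    rcases mem_symsOf_copyIns 0 hu _ _ hxu with ⟨d, hd, rfl⟩ | ⟨d, hd, rfl⟩
    · rcases hx with ⟨c, hc, hcd⟩ | hcd
      · exact hsu c hc (loc_injective 0 hcd ▸ hd)
      · exact loc_ne_glob _ _ _ hcd
    · rcases hx with ⟨c, hc, hcd⟩ | hcd
      · exact loc_ne_glob _ _ _ hcd
      · exact ha₁ (glob_injective hcd ▸ hd)

theorem HS_two_two : HS 2 2 = twoBlocks [2, 3] [2] [8, 5] [8, 2, 8, 5, 3, 5] := by
  rw [HS, HS_two_one, numBlocks_twoBlocks, HS, bullet_S1_two,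
    copyIns_twoBlocks 0 (by simp) (by simp), twoBlocks_append_map_sym]
  simp [loc, glob, Nat.pair]

theorem hasPattern_HS_three_one : HasPattern 1 (HS 3 1) := by
  refine ⟨[2], [], Tok.op :: ([3].map Tok.sym ++ Tok.cl :: Tok.sym 2 ::
    Tok.op :: ([8].map Tok.sym ++ Tok.cl :: Tok.op :: ([5].map Tok.sym ++ Tok.cl ::
      [8, 2, 8, 5, 3, 5].map Tok.sym))), rfl, by simp, ?_, .nil, by simp [symsOf], ?_⟩
  · rw [HS, HS_two_two]
    simp [split2, twoBlocks]
  · refine ⟨[], [3], Tok.sym 2 :: Tok.op :: ([8].map Tok.sym ++ Tok.cl ::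
      Tok.op :: ([5].map Tok.sym ++ Tok.cl :: [8].map Tok.sym)), [8, 5, 3, 5].map Tok.sym,
      by simp, .nil, by simp, ?_, by simp, by simp [symsOf], BlockSeq.map_sym _⟩
    exact .sym 2 (.blk (by simp) (.blk (by simp) (BlockSeq.map_sym _)))

theorem hasPattern_HS_three (m : ℕ) : HasPattern (m + 1) (HS 3 (m + 1)) := by
  induction m with
  | zero => exact hasPattern_HS_three_one
  | succ m ih =>
    have hpos : numBlocks (HS 3 (m + 1)) ≠ 0 := by
      obtain ⟨s, u, T, -, -, hA, -⟩ := ih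
      rw [hA, numBlocks]
      simp [List.count_append]
    obtain ⟨n, hn⟩ := Nat.exists_eq_succ_of_ne_zero hpos
    obtain ⟨α, w, β, z, hB, hlen, -, hnd, hdis, hz⟩ := exists_HS_two_eq n
    rw [HS, hn, Nat.succ_eq_add_one, hB]
    exact ih.bullet (by omega) (by omega) hnd hdis hz

/-- Splitting the endpoint sequence of a concatenation. -/
theorem exists_EAux_append (seen : List ℕ) (x y : List Tok) :
    ∃ (x' : List ETok) (seen' : List ℕ), EAux seen (x ++ y) = x' ++ EAux seen' y ∧
      (∀ a, a ∈ seen' ↔ a ∈ seen ∨ a ∈ symsOf x) ∧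
      ∀ a, ETok.L a ∈ x' ∨ ETok.R a ∈ x' → a ∈ symsOf x := by
  induction x generalizing seen with
  | nil => exact ⟨[], seen, by simp [symsOf]⟩
  | cons t x ih =>
    cases t with
    | op =>
      obtain ⟨x', seen', h, hs, hx⟩ := ih seen
      exact ⟨ETok.op :: x', seen', by simp [EAux, h], hs, by simpa [symsOf] using hx⟩
    | cl =>
      obtain ⟨x', seen', h, hs, hx⟩ := ih seen
      exact ⟨ETok.cl :: x', seen', by simp [EAux, h], hs, by simpa [symsOf] using hx⟩
    | sym a =>
      by_cases ha : a ∈ seen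
      · obtain ⟨x', seen', h, hs, hx⟩ := ih seen
        have hs' : ∀ c, c ∈ seen' ↔ c ∈ seen ∨ c ∈ symsOf (Tok.sym a :: x) := by
          intro c
          rw [hs, symsOf, List.mem_cons]
          constructor
          · tauto
          · rintro (h | rfl | h) <;> tauto
        by_cases hr : a ∈ symsOf (x ++ y)
        · refine ⟨x', seen', by simp [EAux, ha, hr, h], hs', fun c hc => ?_⟩
          exact List.mem_cons_of_mem _ (hx c hc)
        · refine ⟨ETok.R a :: x', seen', by simp [EAux, ha, hr, h], hs', fun c hc => ?_⟩
          have := hx c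
          simp only [List.mem_cons, symsOf, ETok.R.injEq, reduceCtorEq, false_or] at hc ⊢
          tauto
      · obtain ⟨x', seen', h, hs, hx⟩ := ih (a :: seen)
        refine ⟨ETok.L a :: x', seen', by simp [EAux, ha, h], fun c => ?_, fun c hc => ?_⟩
        · rw [hs, symsOf, List.mem_cons, List.mem_cons]
          tauto
        · have := hx c
          simp only [List.mem_cons, symsOf, ETok.L.injEq, reduceCtorEq, false_or] at hc ⊢
          tauto

theorem exists_EAux_firstOccs (seen : List ℕ) {s : List ℕ} (hs : s.Nodup)
    (hseen : ∀ a ∈ s, a ∉ seen) (y : List Tok) :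
    ∃ seen', EAux seen (s.map Tok.sym ++ y) = s.map ETok.L ++ EAux seen' y ∧
      ∀ a ∈ s, a ∈ seen' := by
  suffices ∃ seen', EAux seen (s.map Tok.sym ++ y) = s.map ETok.L ++ EAux seen' y ∧
      ∀ a, a ∈ s ∨ a ∈ seen → a ∈ seen' by
    obtain ⟨seen', h, h'⟩ := this
    exact ⟨seen', h, fun a ha => h' a (.inl ha)⟩
  induction s generalizing seen with
  | nil => exact ⟨seen, by simp⟩
  | cons a s ih =>
    rw [List.nodup_cons] at hs
    obtain ⟨seen', h, h'⟩ := ih (a :: seen) hs.2 (by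
      intro c hc
      rw [List.mem_cons, not_or]
      exact ⟨fun hca => hs.1 (hca ▸ hc), hseen c (List.mem_cons_of_mem _ hc)⟩)
    refine ⟨seen', ?_, fun c hc => h' c ?_⟩
    · simp [EAux, hseen a, h]
    · simp only [List.mem_cons] at hc ⊢
      tauto

/-- Last occurrences separated by special blocks become right endpoints separated by special
blocks of the endpoint sequence. -/
theorem LastOccs.exists_EAux_eq {all : List ℕ} (s : ℕ → ℕ) (n k : ℕ) {T : List Tok}
    (h : LastOccs all ((List.range' k n).map s) T) (seen : List ℕ)
    (hseen : ∀ i ∈ List.range' k n, s i ∈ seen) :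
    ∃ g : ℕ → List ETok,
      EAux seen T = (List.range' k n).foldr (fun i acc => g i ++ ETok.R (s i) :: acc)
        (g (k + n)) ∧
      ∀ i ∈ List.range' k n, ∃ u' b v' : List ETok,
        g i = u' ++ (ETok.op :: b) ++ ETok.cl :: v' ∧
        ∀ a ∈ all, ETok.L a ∉ b ∧ ETok.R a ∉ b := by
  induction n generalizing k T seen with
  | zero => exact ⟨fun _ => EAux seen T, by simp⟩
  | succ n ih =>
    rw [List.range'_succ, List.map_cons] at h
    obtain ⟨u, b, v, T', rfl, -, -, -, hball, hk, hT'⟩ := h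
    obtain ⟨u', seen₁, h₁, hs₁, -⟩ := exists_EAux_append seen u
      (Tok.op :: (b.map Tok.sym ++ Tok.cl :: (v ++ Tok.sym (s k) :: T')))
    obtain ⟨b', seen₂, h₂, hs₂, hb'⟩ := exists_EAux_append seen₁ (b.map Tok.sym)
      (Tok.cl :: (v ++ Tok.sym (s k) :: T'))
    obtain ⟨v', seen₃, h₃, hs₃, -⟩ := exists_EAux_append seen₂ v (Tok.sym (s k) :: T')
    have hmono : ∀ i ∈ List.range' k (n + 1), s i ∈ seen₃ := fun i hi =>
      (hs₃ _).2 (.inl ((hs₂ _).2 (.inl ((hs₁ _).2 (.inl (hseen i hi))))))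
    rw [List.range'_succ] at hmono
    obtain ⟨g, hg, hgb⟩ := ih (k + 1) hT' seen₃ fun i hi => hmono i (List.mem_cons_of_mem _ hi)
    set g₀ := u' ++ (ETok.op :: b') ++ ETok.cl :: v' with hg₀
    have hne : ∀ i, k < i → Function.update g k g₀ i = g i := fun i hi =>
      Function.update_of_ne hi.ne' _ _
    have hlt : ∀ i ∈ List.range' (k + 1) n, k < i := fun i hi => by
      have := List.mem_range'_1.1 hi
      omega
    refine ⟨Function.update g k g₀, ?_, ?_⟩
    · have hfold : (List.range' (k + 1) n).foldr
          (fun i acc => Function.update g k g₀ i ++ ETok.R (s i) :: acc) (g (k + 1 + n)) =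
          (List.range' (k + 1) n).foldr (fun i acc => g i ++ ETok.R (s i) :: acc)
            (g (k + 1 + n)) :=
        List.foldr_ext _ _ _ fun i hi acc => by rw [hne i (hlt i hi)]
      rw [List.range'_succ, List.foldr_cons, show k + (n + 1) = k + 1 + n by omega,
        hne (k + 1 + n) (by omega), hfold, ← hg, Function.update_self, h₁]
      simp only [EAux]
      rw [h₂]
      simp only [EAux]
      rw [h₃]
      simp [EAux, hmono k (by simp), hk, hg₀]
    · intro i hi
      rw [List.range'_succ, List.mem_cons] at hi
      rcases hi with rfl | hi
      · refine ⟨u', b', v', by rw [Function.update_self], fun a ha => ?_⟩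
        rw [← not_or]
        intro hab
        have := hb' a hab
        rw [symsOf_map_sym] at this
        exact hball a this ha
      · rw [hne i (hlt i hi)]
        exact hgb i hi

/-- Corollary `cor_S3`: for every `m ≥ 1`, the endpoint sequence `E(S₃(m))` of the
Hart–Sharir sequence `S₃(m)` contains a subsequence of the form
`(L₁ L₂ ⋯ L_m) ( ) R₁ ( ) R₂ ( ) ⋯ ( ) R_m`:
there are pairwise distinct symbols `s 1, …, s m` such that the letters
`L (s 1), …, L (s m)` constitute (in this order) one entire special block of
`E(S₃(m))`, the letters `R (s 1), …, R (s m)` appear after that block in this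
order, and between the block and `R (s 1)`, as well as between `R (s i)` and
`R (s (i+1))` for each `1 ≤ i ≤ m − 1`, there lies at least one complete special
block of `E(S₃(m))` consisting of letters of symbols other than `s 1, …, s m`. -/
theorem cor_S3 (m : ℕ) (hm : 1 ≤ m) :
    ∃ (s : ℕ → ℕ) (u : List ETok) (g : ℕ → List ETok),
      (∀ i j, 1 ≤ i → i ≤ m → 1 ≤ j → j ≤ m → s i = s j → i = j) ∧
      Efun (HS 3 m) =
        u ++ (ETok.op :: (List.range' 1 m).map fun i => ETok.L (s i)) ++
          ETok.cl :: (List.range' 1 m).foldr (fun i acc => g i ++ ETok.R (s i) :: acc)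
            (g (m + 1)) ∧
      (∀ i, 1 ≤ i → i ≤ m → ∃ (u' : List ETok) (b : List ETok) (v' : List ETok),
        g i = u' ++ (ETok.op :: b) ++ ETok.cl :: v' ∧
        ∀ t ∈ b, ∀ j, 1 ≤ j → j ≤ m → t ≠ ETok.L (s j) ∧ t ≠ ETok.R (s j)) := by
  obtain ⟨n, rfl⟩ : ∃ n, m = n + 1 := ⟨m - 1, by omega⟩
  obtain ⟨l, u, T, hlen, hnd, hA, -, hlu, hT⟩ := hasPattern_HS_three n
  set s : ℕ → ℕ := fun i => l.getD (i - 1) 0 with hs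
  have hl : (List.range' 1 (n + 1)).map s = l := by
    apply List.ext_getElem
    · simp [hlen]
    · intro i h₁ h₂
      simp [hs, h₂]
  have hrange : ∀ i, 1 ≤ i → i ≤ n + 1 → i ∈ List.range' 1 (n + 1) := fun i hi hi' =>
    List.mem_range'_1.2 ⟨hi, by omega⟩
  obtain ⟨u', seen₁, h₁, hs₁, -⟩ := exists_EAux_append [] u
    (Tok.op :: (l.map Tok.sym ++ Tok.cl :: T))
  obtain ⟨seen₂, h₂, hs₂⟩ := exists_EAux_firstOccs seen₁ hnd
    (fun a ha h => by simpa [hlu a ha] using (hs₁ a).1 h) (Tok.cl :: T)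
  obtain ⟨g, hg, hgb⟩ := LastOccs.exists_EAux_eq (all := l) (T := T) s (n + 1) 1
    (by rwa [hl]) seen₂ (fun i hi => hs₂ _ (hl ▸ List.mem_map_of_mem hi))
  refine ⟨s, u', g, ?_, ?_, ?_⟩
  · intro i j hi hi' hj hj' hij
    rw [← hl] at hnd
    exact List.inj_on_of_nodup_map hnd (hrange i hi hi') (hrange j hj hj') hij
  · have hmap : ((List.range' 1 (n + 1)).map fun i => ETok.L (s i)) = l.map ETok.L := by
      rw [← hl, List.map_map]
      rfl
    rw [hmap, Efun, hA, h₁]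
    simp only [EAux]
    rw [h₂]
    simp only [EAux]
    rw [hg, Nat.add_comm 1 (n + 1)]
    simp
  · intro i hi hi'
    obtain ⟨u₁, b, v₁, hgi, hb⟩ := hgb i (hrange i hi hi')
    refine ⟨u₁, b, v₁, hgi, fun t ht j hj hj' => ?_⟩
    have hj := hb (s j) (hl ▸ List.mem_map_of_mem (hrange j hj hj'))
    exact ⟨fun h => hj.1 (h ▸ ht), fun h => hj.2 (h ▸ ht)⟩
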